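/- arXiv:1708.01570 — 3 statements merged into one kernel-verified Lean document; each statement's English description precedes it below -/
import Mathlib

section
/- For each real number p with 1 < p < 2 there exists a real Banach space X that is isomorphic (as a topological vector space, i.e., linearly homeomorphic) to ℓ_p, such that the five-element set U := {e₁, e₂, −e₁, −e₂, 0}, considered as a metric subspace of ℓ_p, does not embed isometrically into X; that is, there is no map f : U → X with ‖f(u) − f(v)‖_X = ‖u − v‖_p for all u, v ∈ U. -/
open scoped ENNReal

section RpowInequalities

theorem Real.rpow_add_lt_add_rpow {a b q : ℝ} (ha : 0 < a) (hb : 0 < b) (hq : q < 1) :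
    (a + b) ^ q < a ^ q + b ^ q := by
  have hab : 0 < a + b := add_pos ha hb
  have h1 : (a + b) ^ (q - 1) < a ^ (q - 1) :=
    Real.rpow_lt_rpow_of_neg ha (by linarith) (by linarith)
  have h2 : (a + b) ^ (q - 1) < b ^ (q - 1) :=
    Real.rpow_lt_rpow_of_neg hb (by linarith) (by linarith)
  have split (x : ℝ) (hx : 0 < x) : x ^ q = x * x ^ (q - 1) := by
    rw [Real.rpow_sub_one hx.ne']; field_simp
  rw [split _ ha, split _ hb, split _ hab, add_mul]
  exact add_lt_add (mul_lt_mul_of_pos_left h1 ha) (mul_lt_mul_of_pos_left h2 hb)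

theorem Real.rpow_add_rpow_le_two_mul {s t q : ℝ} (hs : 0 ≤ s) (ht : 0 ≤ t)
    (hq₀ : 0 ≤ q) (hq₁ : q ≤ 1) : s ^ q + t ^ q ≤ 2 * ((s + t) / 2) ^ q := by
  have h := (Real.concaveOn_rpow hq₀ hq₁).2 (Set.mem_Ici.2 hs) (Set.mem_Ici.2 ht)
    (by norm_num : (0 : ℝ) ≤ 1 / 2) (by norm_num : (0 : ℝ) ≤ 1 / 2) (by norm_num)
  simp only [smul_eq_mul] at h
  rw [show 1 / 2 * s + 1 / 2 * t = (s + t) / 2 by ring] at h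
  linarith

theorem Real.sq_rpow_half {x : ℝ} (hx : 0 ≤ x) (p : ℝ) : (x ^ 2) ^ (p / 2) = x ^ p := by
  rw [← Real.rpow_natCast_mul hx]
  congr 1
  push_cast
  ring

end RpowInequalities

section InnerProductSpace

variable {E : Type*} [NormedAddCommGroup E] [InnerProductSpace ℝ E] {p : ℝ}

theorem norm_add_rpow_add_norm_sub_rpow_le_rpow_sq (hp₀ : 0 ≤ p) (hp₂ : p ≤ 2) (u v : E) :
    ‖u + v‖ ^ p + ‖u - v‖ ^ p ≤ 2 * (‖u‖ ^ 2 + ‖v‖ ^ 2) ^ (p / 2) := by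
  have h := Real.rpow_add_rpow_le_two_mul (sq_nonneg ‖u + v‖) (sq_nonneg ‖u - v‖)
    (by linarith : 0 ≤ p / 2) (by linarith)
  rwa [parallelogram_law_with_norm ℝ, mul_div_cancel_left₀ _ two_ne_zero,
    Real.sq_rpow_half (norm_nonneg _), Real.sq_rpow_half (norm_nonneg _)] at h

theorem norm_add_rpow_add_norm_sub_rpow_lt (hp₀ : 0 ≤ p) (hp₂ : p < 2) {u v : E}
    (hu : u ≠ 0) (hv : v ≠ 0) :
    ‖u + v‖ ^ p + ‖u - v‖ ^ p < 2 * (‖u‖ ^ p + ‖v‖ ^ p) := by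
  have h := Real.rpow_add_lt_add_rpow (pow_pos (norm_pos_iff.2 hu) 2)
    (pow_pos (norm_pos_iff.2 hv) 2) (by linarith : p / 2 < 1)
  rw [Real.sq_rpow_half (norm_nonneg _), Real.sq_rpow_half (norm_nonneg _)] at h
  linarith [norm_add_rpow_add_norm_sub_rpow_le_rpow_sq hp₀ hp₂.le u v]

theorem norm_add_rpow_add_norm_sub_rpow_le (hp₀ : 0 < p) (hp₂ : p < 2) (u v : E) :
    ‖u + v‖ ^ p + ‖u - v‖ ^ p ≤ 2 * (‖u‖ ^ p + ‖v‖ ^ p) := by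
  rcases eq_or_ne u 0 with rfl | hu
  · simp [Real.zero_rpow hp₀.ne', two_mul]
  rcases eq_or_ne v 0 with rfl | hv
  · simp [Real.zero_rpow hp₀.ne', two_mul]
  exact (norm_add_rpow_add_norm_sub_rpow_lt hp₀.le hp₂ hu hv).le

end InnerProductSpace

section MidpointConvexity

variable {E : Type*} [NormedAddCommGroup E] {p : ℝ}

theorem norm_add_rpow_le (hp : 1 ≤ p) (u v : E) :
    ‖u + v‖ ^ p ≤ 2 ^ p * ((‖u‖ ^ p + ‖v‖ ^ p) / 2) := by
  have h := (convexOn_rpow hp).2 (Set.mem_Ici.2 (norm_nonneg u)) (Set.mem_Ici.2 (norm_nonneg v))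
    (by norm_num : (0 : ℝ) ≤ 1 / 2) (by norm_num : (0 : ℝ) ≤ 1 / 2) (by norm_num)
  simp only [smul_eq_mul] at h
  calc ‖u + v‖ ^ p ≤ (2 * (1 / 2 * ‖u‖ + 1 / 2 * ‖v‖)) ^ p := by
        gcongr
        linarith [norm_add_le u v]
    _ = 2 ^ p * (1 / 2 * ‖u‖ + 1 / 2 * ‖v‖) ^ p := Real.mul_rpow (by norm_num) (by positivity)
    _ ≤ 2 ^ p * ((‖u‖ ^ p + ‖v‖ ^ p) / 2) := by
        gcongr
        linarith

theorem norm_add_rpow_lt [NormedSpace ℝ E] [StrictConvexSpace ℝ E] (hp : 1 < p) {u v : E} (huv : u ≠ v) :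
    ‖u + v‖ ^ p < 2 ^ p * ((‖u‖ ^ p + ‖v‖ ^ p) / 2) := by
  by_cases hn : ‖u‖ = ‖v‖
  · have hlt : ‖u + v‖ < 2 * ‖v‖ := by
      have := not_sameRay_iff_norm_add_lt.1 (mt (sameRay_iff_of_norm_eq hn).1 huv)
      linarith
    calc ‖u + v‖ ^ p < (2 * ‖v‖) ^ p :=
          Real.rpow_lt_rpow (norm_nonneg _) hlt (by linarith)
      _ = 2 ^ p * ((‖u‖ ^ p + ‖v‖ ^ p) / 2) := by
          rw [Real.mul_rpow (by norm_num) (norm_nonneg _), hn, add_self_div_two]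
  · have h := (strictConvexOn_rpow hp).2 (Set.mem_Ici.2 (norm_nonneg u))
      (Set.mem_Ici.2 (norm_nonneg v)) hn
      (by norm_num : (0 : ℝ) < 1 / 2) (by norm_num : (0 : ℝ) < 1 / 2) (by norm_num)
    simp only [smul_eq_mul] at h
    calc ‖u + v‖ ^ p ≤ (2 * (1 / 2 * ‖u‖ + 1 / 2 * ‖v‖)) ^ p := by
          gcongr
          linarith [norm_add_le u v]
      _ = 2 ^ p * (1 / 2 * ‖u‖ + 1 / 2 * ‖v‖) ^ p := Real.mul_rpow (by norm_num) (by positivity)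
      _ < 2 ^ p * ((‖u‖ ^ p + ‖v‖ ^ p) / 2) := by
          gcongr
          linarith

end MidpointConvexity

section LpSequences

variable {α : Type*}

theorem lp.norm_add_rpow_add_norm_sub_rpow_le {P : ℝ≥0∞} (hp₀ : 0 < P.toReal)
    (hp₂ : P.toReal < 2) (x y : lp (fun _ : α => ℝ) P) :
    ‖x + y‖ ^ P.toReal + ‖x - y‖ ^ P.toReal ≤ 2 * (‖x‖ ^ P.toReal + ‖y‖ ^ P.toReal) := by
  have hs (z : lp (fun _ : α => ℝ) P) := (lp.hasSum_norm hp₀ z)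
  refine hasSum_le (fun i => ?_) ((hs (x + y)).add (hs (x - y))) (((hs x).add (hs y)).mul_left 2)
  simpa using _root_.norm_add_rpow_add_norm_sub_rpow_le hp₀ hp₂ (x i) (y i)

/-- The inclusion of `ℓ^P` into `ℓ^Q` for `P ≤ Q` is continuous. -/
noncomputable def lp.inclusionCLM {P Q : ℝ≥0∞} [Fact (1 ≤ P)] [Fact (1 ≤ Q)] (h : P ≤ Q) :
    lp (fun _ : α => ℝ) P →L[ℝ] lp (fun _ : α => ℝ) Q :=
  ContinuousLinearMap.ofSeqClosedGraph (g := lp.linearMapOfLE ℝ (fun _ : α => ℝ) h) <| by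
    intro u x y hx hy
    ext i
    have h1 := ((lp.evalCLM ℝ (fun _ : α => ℝ) P i).continuous.tendsto x).comp hx
    have h2 := ((lp.evalCLM ℝ (fun _ : α => ℝ) Q i).continuous.tendsto y).comp hy
    exact tendsto_nhds_unique h2 h1

theorem lp.inclusionCLM_injective {P Q : ℝ≥0∞} [Fact (1 ≤ P)] [Fact (1 ≤ Q)] (h : P ≤ Q) :
    Function.Injective (lp.inclusionCLM (α := α) h) := fun x y hxy => by
  ext i
  exact congrArg (fun z : lp (fun _ : α => ℝ) Q => z i) hxy

end LpSequences

section GraphNorm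

theorem WithLp.prod_norm_rpow {E F : Type*} [NormedAddCommGroup E] [NormedAddCommGroup F] {P : ℝ≥0∞} [Fact (1 ≤ P)] (hP : 0 < P.toReal)
    (z : WithLp P (E × F)) : ‖z‖ ^ P.toReal = ‖z.fst‖ ^ P.toReal + ‖z.snd‖ ^ P.toReal := by
  rw [WithLp.prod_norm_eq_add hP, one_div, Real.rpow_inv_rpow (by positivity) hP.ne']

/-- Renorming a Banach space `E` by `‖x‖ = (‖x‖ ^ P + ‖T x‖ ^ P) ^ (1 / P)`. -/
theorem exists_equiv_norm_rpow_eq_add {E F : Type} [NormedAddCommGroup E] [NormedSpace ℝ E]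
    [CompleteSpace E] [NormedAddCommGroup F] [NormedSpace ℝ F] {P : ℝ≥0∞} [Fact (1 ≤ P)]
    (hP : 0 < P.toReal) (T : E →L[ℝ] F) :
    ∃ (X : Type) (_ : NormedAddCommGroup X) (_ : NormedSpace ℝ X) (_ : CompleteSpace X)
      (e : E ≃L[ℝ] X),
      ∀ x, ‖x‖ ^ P.toReal = ‖e.symm x‖ ^ P.toReal + ‖T (e.symm x)‖ ^ P.toReal := by
  let J : E →L[ℝ] WithLp P (E × F) :=
    (WithLp.prodContinuousLinearEquiv P ℝ E F).symm.toContinuousLinearMap.comp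
      ((ContinuousLinearMap.id ℝ E).prod T)
  have hJ (x : E) : ‖J x‖ ^ P.toReal = ‖x‖ ^ P.toReal + ‖T x‖ ^ P.toReal :=
    WithLp.prod_norm_rpow hP (J x)
  have hle (x : E) : ‖x‖ ≤ ‖J x‖ := by
    rw [← Real.rpow_le_rpow_iff (norm_nonneg _) (norm_nonneg _) hP, hJ]
    exact le_add_of_nonneg_right (by positivity)
  have hinj : Function.Injective J := (injective_iff_map_eq_zero J).2 fun x hx => by
    simpa [hx] using hle x
  let e₀ := LinearEquiv.ofInjective J.toLinearMap hinj
  let e : E ≃L[ℝ] LinearMap.range J.toLinearMap :=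
    e₀.toContinuousLinearEquivOfBounds ‖J‖ 1 (fun x => J.le_opNorm x) fun y => by
      obtain ⟨x, rfl⟩ := e₀.surjective y
      rw [LinearEquiv.symm_apply_apply, one_mul]
      exact hle x
  refine ⟨LinearMap.range J.toLinearMap, inferInstance, inferInstance,
    (completeSpace_congr (e := e.toEquiv) e.isUniformEmbedding).1 inferInstance, e, fun y => ?_⟩
  obtain ⟨x, rfl⟩ := e.surjective y
  rw [ContinuousLinearEquiv.symm_apply_apply]
  exact hJ x

end GraphNorm

theorem lp.norm_single_add_single_rpow {α : Type*} [DecidableEq α] {P : ℝ≥0∞}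
    (hP : 0 < P.toReal) {i j : α} (hij : i ≠ j) (a b : ℝ) :
    ‖(lp.single P i a + lp.single P j b : lp (fun _ : α => ℝ) P)‖ ^ P.toReal =
      |a| ^ P.toReal + |b| ^ P.toReal := by
  have h := lp.norm_sum_single hP (E := fun _ : α => ℝ) (Pi.single i a + Pi.single j b) {i, j}
  simpa [Finset.sum_pair hij, hij, hij.symm] using h

/-- In a normed group with strictly midpoint convex `‖·‖ ^ p` and strict type `p` inequality for
two nonzero vectors, there is no isometric copy of the five-point cross of `ℓ_p^2`. -/
theorem not_exists_isometric_cross {E X : Type*} [NormedAddCommGroup E] [NormedSpace ℝ E]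
    [NormedAddCommGroup X] {p : ℝ}
    (hconvex : ∀ x y : X, x ≠ y → ‖x + y‖ ^ p < 2 ^ p * ((‖x‖ ^ p + ‖y‖ ^ p) / 2))
    (htype : ∀ x y : X, x ≠ 0 → y ≠ 0 → ‖x + y‖ ^ p + ‖x - y‖ ^ p < 2 * (‖x‖ ^ p + ‖y‖ ^ p))
    {e₀ e₁ : E} (h₀ : ‖e₀‖ = 1) (h₁ : ‖e₁‖ = 1) (hadd : ‖e₀ + e₁‖ ^ p = 2)
    (hsub : ‖e₀ - e₁‖ ^ p = 2) :
    ¬ ∃ f : ({e₀, e₁, -e₀, -e₁, 0} : Set E) → X,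
      ∀ u v, ‖f u - f v‖ = ‖(u : E) - (v : E)‖ := by
  rintro ⟨f, hf⟩
  obtain ⟨a, b, b', c, hac, hbc, hcb', hbb', hab, hab'⟩ : ∃ a b b' c : X,
      ‖a - c‖ = 1 ∧ ‖b - c‖ = 1 ∧ ‖c - b'‖ = 1 ∧ ‖b - b'‖ = 2 ∧
      ‖a - b‖ ^ p = 2 ∧ ‖a - b'‖ ^ p = 2 := by
    refine ⟨f ⟨e₀, by simp⟩, f ⟨e₁, by simp⟩, f ⟨-e₁, by simp⟩, f ⟨0, by simp⟩, ?_⟩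
    simp only [hf, sub_zero, sub_neg_eq_add, zero_add]
    refine ⟨h₀, h₁, h₁, ?_, hsub, hadd⟩
    rw [← two_smul ℝ e₁, norm_smul, h₁]
    norm_num
  have hmid : b - c = c - b' := by
    by_contra hne
    have h := hconvex _ _ hne
    rw [sub_add_sub_cancel, hbc, hcb', hbb'] at h
    simp at h
  have h := htype (a - c) (b - c) (norm_ne_zero_iff.1 (by simp [hac]))
    (norm_ne_zero_iff.1 (by simp [hbc]))
  rw [sub_sub_sub_cancel_right, hac, hbc, hab, hmid, sub_add_sub_cancel, hab'] at h
  norm_num at h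

/-- **There is no finitely isometric Krivine theorem, case `1 < p < 2`.**
For each `1 < p < 2` there exists a Banach space `X` isomorphic to `ℓ_p` such that the
set `U = {e₁, e₂, -e₁, -e₂, 0} ⊆ ℓ_p` does not embed isometrically into `X`. -/
theorem no_finite_isometric_krivine_lt_two (p : ℝ) (hp1 : 1 < p) (hp2 : p < 2) :
    haveI : Fact ((1 : ℝ≥0∞) ≤ ENNReal.ofReal p) := ⟨ENNReal.one_le_ofReal.mpr hp1.le⟩
    ∃ (X : Type) (_ : NormedAddCommGroup X) (_ : NormedSpace ℝ X) (_ : CompleteSpace X),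
      Nonempty (lp (fun _ : ℕ => ℝ) (ENNReal.ofReal p) ≃L[ℝ] X) ∧
      ¬ ∃ f : ({lp.single (ENNReal.ofReal p) 0 (1 : ℝ),
                lp.single (ENNReal.ofReal p) 1 (1 : ℝ),
                -lp.single (ENNReal.ofReal p) 0 (1 : ℝ),
                -lp.single (ENNReal.ofReal p) 1 (1 : ℝ), 0} :
              Set (lp (fun _ : ℕ => ℝ) (ENNReal.ofReal p))) → X,
          ∀ u v, ‖f u - f v‖ =
            ‖(u : lp (fun _ : ℕ => ℝ) (ENNReal.ofReal p)) -
             (v : lp (fun _ : ℕ => ℝ) (ENNReal.ofReal p))‖ := by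
  have : Fact ((1 : ℝ≥0∞) ≤ ENNReal.ofReal p) := ⟨ENNReal.one_le_ofReal.mpr hp1.le⟩
  have hp0 : 0 < p := by linarith
  have hP : (ENNReal.ofReal p).toReal = p := ENNReal.toReal_ofReal hp0.le
  have hP0 : 0 < (ENNReal.ofReal p).toReal := hP.symm ▸ hp0
  have hP2 : ENNReal.ofReal p ≤ 2 := by
    simpa using ENNReal.ofReal_le_ofReal hp2.le
  let T := lp.inclusionCLM (α := ℕ) hP2
  obtain ⟨X, _, _, _, e, he⟩ := exists_equiv_norm_rpow_eq_add hP0 T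
  rw [hP] at he
  refine ⟨X, inferInstance, inferInstance, inferInstance, ⟨e⟩, ?_⟩
  have hinj (x y : X) (h : T (e.symm x) = T (e.symm y)) : x = y :=
    e.symm.injective (lp.inclusionCLM_injective hP2 h)
  have hconvex (x y : X) (hxy : x ≠ y) :
      ‖x + y‖ ^ p < 2 ^ p * ((‖x‖ ^ p + ‖y‖ ^ p) / 2) := by
    have h1 := norm_add_rpow_le hp1.le (e.symm x) (e.symm y)
    have h2 := norm_add_rpow_lt hp1 (mt (hinj x y) hxy)
    rw [he, he, he, map_add, map_add]
    linarith
  have htype (x y : X) (hx : x ≠ 0) (hy : y ≠ 0) :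
      ‖x + y‖ ^ p + ‖x - y‖ ^ p < 2 * (‖x‖ ^ p + ‖y‖ ^ p) := by
    have h1 := lp.norm_add_rpow_add_norm_sub_rpow_le hP0 (by rwa [hP]) (e.symm x) (e.symm y)
    have h2 := norm_add_rpow_add_norm_sub_rpow_lt hp0.le hp2
      (u := T (e.symm x)) (v := T (e.symm y))
      (fun h => hx (hinj x 0 (by simpa using h))) (fun h => hy (hinj y 0 (by simpa using h)))
    rw [hP] at h1
    rw [he, he, he, he, map_add, map_sub, map_add, map_sub]
    linarith
  have hone (i : ℕ) : ‖lp.single (E := fun _ : ℕ => ℝ) (ENNReal.ofReal p) i 1‖ = 1 := by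
    rw [lp.norm_single (by simpa using hp0)]; simp
  have hsum (b : ℝ) (hb : |b| = 1) :
      ‖(lp.single (ENNReal.ofReal p) 0 1 + lp.single (ENNReal.ofReal p) 1 b :
        lp (fun _ : ℕ => ℝ) (ENNReal.ofReal p))‖ ^ p = 2 := by
    have h := lp.norm_single_add_single_rpow hP0 (zero_ne_one (α := ℕ)) 1 b
    rw [hP, hb] at h
    rw [h]; norm_num
  have hsub := hsum (-1) (by simp)
  rw [lp.single_neg, ← sub_eq_add_neg] at hsub
  exact not_exists_isometric_cross hconvex htype (hone 0) (hone 1) (hsum 1 (by simp)) hsub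
end

section
/- For each real number p with 2 < p < ∞ there exists a real Banach space X that is isomorphic (linearly homeomorphic) to ℓ_p, such that the five-element set V := {2^{−1/p}(e₁+e₂), −2^{−1/p}(e₁+e₂), 2^{−1/p}(e₁−e₂), −2^{−1/p}(e₁−e₂), 0}, considered as a metric subspace of ℓ_p, does not embed isometrically into X; that is, there is no map f : V → X with ‖f(u) − f(v)‖_X = ‖u − v‖_p for all u, v ∈ V. -/
open scoped ENNReal

/-- Clarkson's inequality for exponents `p > 2` in an inner product space. -/
theorem norm_add_rpow_add_norm_sub_rpow_le_s1 {H : Type*} [NormedAddCommGroup H]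
    [InnerProductSpace ℝ H] {p : ℝ} (hp : 2 < p) (u v : H) :
    ‖u + v‖ ^ p + ‖u - v‖ ^ p ≤ 2 ^ (p - 1) * (‖u‖ ^ p + ‖v‖ ^ p) ∧
      (‖u + v‖ ^ p + ‖u - v‖ ^ p = 2 ^ (p - 1) * (‖u‖ ^ p + ‖v‖ ^ p) → u = v ∨ u = -v) := by
  have rpow_eq (w : H) : ‖w‖ ^ p = (‖w‖ ^ 2) ^ (p / 2) := by
    rw [← Real.rpow_natCast_mul (norm_nonneg w)]
    congr 1
    push_cast
    ring
  have hq : 1 < p / 2 := by linarith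
  have mean : (‖u + v‖ ^ 2 + ‖u - v‖ ^ 2) ^ (p / 2) ≤ 2 ^ (p - 1) * (‖u‖ ^ p + ‖v‖ ^ p) := by
    have par : ‖u + v‖ ^ 2 + ‖u - v‖ ^ 2 = 2 * (‖u‖ ^ 2 + ‖v‖ ^ 2) := by
      have := parallelogram_law_with_norm ℝ u v
      nlinarith
    have two : (2 : ℝ) ^ (p - 1) = 2 ^ (p / 2) * 2 ^ (p / 2 - 1) := by
      rw [← Real.rpow_add two_pos]
      congr 1
      ring
    rw [par, Real.mul_rpow two_pos.le (by positivity), two, mul_assoc, rpow_eq u, rpow_eq v]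
    gcongr
    exact_mod_cast NNReal.rpow_add_le_mul_rpow_add_rpow (‖u‖₊ ^ (2 : ℕ)) (‖v‖₊ ^ (2 : ℕ)) hq.le
  constructor
  · refine le_trans ?_ mean
    rw [rpow_eq, rpow_eq]
    exact Real.add_rpow_le_rpow_add (sq_nonneg _) (sq_nonneg _) hq.le
  · intro h
    by_contra! hne
    have pos_sub : 0 < ‖u - v‖ ^ 2 := by
      have := norm_pos_iff.2 (sub_ne_zero.2 hne.1)
      positivity
    have pos_add : 0 < ‖u + v‖ ^ 2 := by
      have : 0 < ‖u + v‖ := norm_pos_iff.2 fun h => hne.2 (eq_neg_of_add_eq_zero_left h)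
      positivity
    rw [← h, rpow_eq (u + v), rpow_eq (u - v)] at mean
    refine mean.not_gt ?_
    set a := ‖u + v‖ ^ 2
    set b := ‖u - v‖ ^ 2
    have split {t : ℝ} (ht : 0 < t) : t ^ (p / 2) = t * t ^ (p / 2 - 1) := by
      rw [← Real.rpow_one_add' ht.le (by linarith)]
      congr 1
      ring
    rw [split pos_add, split pos_sub, split (add_pos pos_add pos_sub), add_mul]
    gcongr <;> linarith

section

variable (P : ℝ≥0∞)

/-- Clarkson's inequality in `ℓ_p` for `p > 2`. -/
theorem lp_norm_add_rpow_add_norm_sub_rpow_le (hP : 2 < P.toReal) (x y : lp (fun _ : ℕ => ℝ) P) :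
    ‖x + y‖ ^ P.toReal + ‖x - y‖ ^ P.toReal ≤
      2 ^ (P.toReal - 1) * (‖x‖ ^ P.toReal + ‖y‖ ^ P.toReal) := by
  have hpos : 0 < P.toReal := by linarith
  exact hasSum_le (fun i => (norm_add_rpow_add_norm_sub_rpow_le_s1 hP (x i) (y i)).1)
    ((lp.hasSum_norm hpos (x + y)).add (lp.hasSum_norm hpos (x - y)))
    (((lp.hasSum_norm hpos x).add (lp.hasSum_norm hpos y)).mul_left _)

theorem lp_norm_rpow_of_forall_two_le (hP : 0 < P.toReal) (x : lp (fun _ : ℕ => ℝ) P)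
    (hx : ∀ n, 2 ≤ n → x n = 0) : ‖x‖ ^ P.toReal = |x 0| ^ P.toReal + |x 1| ^ P.toReal := by
  rw [lp.norm_rpow_eq_tsum hP, tsum_eq_sum (s := Finset.range 2), Finset.sum_range_succ,
    Finset.sum_range_one]
  · rfl
  · intro n hn
    rw [hx n (not_lt.1 (mt Finset.mem_range.2 hn)), norm_zero, Real.zero_rpow hP.ne']

theorem lp_norm_smul_single_add_single {c : ℝ} (hP : 0 < P.toReal) (hc : 0 ≤ c)
    (hcP : c ^ P.toReal = 2⁻¹) {s : ℝ} (hs : |s| = 1) {x : lp (fun _ : ℕ => ℝ) P}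
    (hx : ∀ n, x n = c * ((Pi.single 0 1 : ℕ → ℝ) n + s * (Pi.single 1 1 : ℕ → ℝ) n)) :
    ‖x‖ = 1 := by
  have h := lp_norm_rpow_of_forall_two_le P hP x fun n hn => by
    rw [hx, Pi.single_eq_of_ne (by lia), Pi.single_eq_of_ne (by lia)]
    ring
  have h0 : |x 0| = c := by simp [hx, abs_of_nonneg hc]
  have h1 : |x 1| = c := by simp [hx, abs_mul, abs_of_nonneg hc, hs]
  rw [h0, h1, hcP] at h
  rw [← Real.rpow_left_inj (lp.norm_nonneg' x) zero_le_one hP.ne', h, Real.one_rpow]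
  norm_num

theorem lp_norm_smul_single_add {c : ℝ} (hP : 0 < P.toReal) (hc : 0 ≤ c)
    (hcP : c ^ P.toReal = 2⁻¹) :
    ‖c • (lp.single P 0 1 + lp.single P 1 1 : lp (fun _ : ℕ => ℝ) P)‖ = 1 :=
  lp_norm_smul_single_add_single P hP hc hcP (s := 1) abs_one fun n => by
    rw [one_mul]
    rfl

theorem lp_norm_smul_single_sub {c : ℝ} (hP : 0 < P.toReal) (hc : 0 ≤ c)
    (hcP : c ^ P.toReal = 2⁻¹) :
    ‖c • (lp.single P 0 1 - lp.single P 1 1 : lp (fun _ : ℕ => ℝ) P)‖ = 1 :=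
  lp_norm_smul_single_add_single P hP hc hcP (s := -1) (by simp) fun n => by
    rw [neg_one_mul, ← sub_eq_add_neg]
    rfl

variable [Fact (1 ≤ P)]

theorem lp_evalCLM_apply (x : lp (fun _ : ℕ => ℝ) P) (n : ℕ) :
    lp.evalCLM ℝ (fun _ : ℕ => ℝ) P n x = x n := rfl

/-- The injective diagonal operator `x ↦ (2⁻ⁿ xₙ)` from `ℓ_p` to `ℓ_2`. -/
noncomputable def diagToL2 : lp (fun _ : ℕ => ℝ) P →L[ℝ] lp (fun _ : ℕ => ℝ) 2 :=
  ∑' n : ℕ, ((1 / 2 : ℝ) ^ n) •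
    (lp.evalCLM ℝ (fun _ : ℕ => ℝ) P n).smulRight (lp.single 2 n (1 : ℝ))

theorem diagToL2_apply (x : lp (fun _ : ℕ => ℝ) P) (m : ℕ) :
    diagToL2 P x m = (1 / 2 : ℝ) ^ m * x m := by
  have hsum : Summable fun n : ℕ => ((1 / 2 : ℝ) ^ n) •
      (lp.evalCLM ℝ (fun _ : ℕ => ℝ) P n).smulRight (lp.single 2 n (1 : ℝ)) := by
    refine Summable.of_norm_bounded summable_geometric_two fun n => ?_
    refine ContinuousLinearMap.opNorm_le_bound _ (by positivity) fun y => ?_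
    have hy : |y n| ≤ ‖y‖ := lp.norm_apply_le_norm (zero_lt_one.trans_le Fact.out).ne' y n
    simpa [norm_smul, lp_evalCLM_apply] using hy
  have h1 := (hsum.hasSum.mapL (ContinuousLinearMap.apply ℝ _ x)).mapL
    (lp.evalCLM ℝ (fun _ : ℕ => ℝ) 2 m)
  have h2 := hasSum_single m (f := fun n => lp.evalCLM ℝ (fun _ : ℕ => ℝ) 2 m
    (ContinuousLinearMap.apply ℝ _ x (((1 / 2 : ℝ) ^ n) •
      (lp.evalCLM ℝ (fun _ : ℕ => ℝ) P n).smulRight (lp.single 2 n (1 : ℝ))))) (by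
    intro n hn
    simp [lp_evalCLM_apply, Pi.single_eq_of_ne hn.symm])
  have h3 := h1.unique h2
  simpa [diagToL2, lp_evalCLM_apply] using h3

theorem diagToL2_injective : Function.Injective (diagToL2 P) := by
  intro x y h
  ext n
  have := congrArg (fun z : lp (fun _ : ℕ => ℝ) 2 => z n) h
  simpa [diagToL2_apply] using this

/-- The embedding `x ↦ (x, Tx)` of `ℓ_p` into `ℓ_p ⊕_p ℓ_2`, where `T` is `diagToL2`. -/
noncomputable def graphEmbedding : lp (fun _ : ℕ => ℝ) P →L[ℝ]
    WithLp P (lp (fun _ : ℕ => ℝ) P × lp (fun _ : ℕ => ℝ) 2) :=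
  (WithLp.prodContinuousLinearEquiv P ℝ _ _).symm.toContinuousLinearMap ∘L
    (ContinuousLinearMap.id ℝ _).prod (diagToL2 P)

theorem graphEmbedding_norm_rpow (hP : 0 < P.toReal) (x : lp (fun _ : ℕ => ℝ) P) :
    ‖graphEmbedding P x‖ ^ P.toReal = ‖x‖ ^ P.toReal + ‖diagToL2 P x‖ ^ P.toReal := by
  rw [WithLp.prod_norm_eq_add hP, ← Real.rpow_mul (by positivity), one_div_mul_cancel hP.ne',
    Real.rpow_one]
  rfl

theorem graphEmbedding_antilipschitz : AntilipschitzWith 1 (graphEmbedding P) :=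
  (graphEmbedding P).antilipschitz_of_bound fun x => by
    simpa using! WithLp.norm_fst_le _ (graphEmbedding P x)

theorem graphEmbedding_clarkson (hP : 2 < P.toReal) (x y : lp (fun _ : ℕ => ℝ) P) :
    ‖graphEmbedding P x + graphEmbedding P y‖ ^ P.toReal +
        ‖graphEmbedding P x - graphEmbedding P y‖ ^ P.toReal ≤
      2 ^ (P.toReal - 1) * (‖graphEmbedding P x‖ ^ P.toReal + ‖graphEmbedding P y‖ ^ P.toReal) ∧
    (‖graphEmbedding P x + graphEmbedding P y‖ ^ P.toReal +
        ‖graphEmbedding P x - graphEmbedding P y‖ ^ P.toReal =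
      2 ^ (P.toReal - 1) * (‖graphEmbedding P x‖ ^ P.toReal + ‖graphEmbedding P y‖ ^ P.toReal) →
      x = y ∨ x = -y) := by
  have hpos : 0 < P.toReal := by linarith
  have h1 := lp_norm_add_rpow_add_norm_sub_rpow_le P hP x y
  obtain ⟨h2, h3⟩ := norm_add_rpow_add_norm_sub_rpow_le_s1 hP (diagToL2 P x) (diagToL2 P y)
  simp only [← map_add, ← map_sub, graphEmbedding_norm_rpow P hpos] at h2 h3 ⊢
  refine ⟨by linarith, fun h => ?_⟩
  refine (h3 (by linarith)).imp (fun h => diagToL2_injective P h) fun h => ?_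
  exact diagToL2_injective P (by rw [h, map_neg])

theorem graphEmbedding_range_clarkson (hP : 2 < P.toReal) (x y : (graphEmbedding P).range) :
    ‖x + y‖ ^ P.toReal + ‖x - y‖ ^ P.toReal ≤
        2 ^ (P.toReal - 1) * (‖x‖ ^ P.toReal + ‖y‖ ^ P.toReal) ∧
      (‖x + y‖ ^ P.toReal + ‖x - y‖ ^ P.toReal =
        2 ^ (P.toReal - 1) * (‖x‖ ^ P.toReal + ‖y‖ ^ P.toReal) → x = y ∨ x = -y) := by
  obtain ⟨u, hu⟩ := x.2
  obtain ⟨v, hv⟩ := y.2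
  have h := graphEmbedding_clarkson P hP u v
  replace hu : graphEmbedding P u = x := hu
  replace hv : graphEmbedding P v = y := hv
  refine ⟨by simpa only [hu, hv] using! h.1, fun heq => ?_⟩
  refine (h.2 (by simpa only [hu, hv] using! heq)).imp (fun huv => ?_) fun huv => ?_
  · exact Subtype.ext (by rw [← hu, ← hv, huv])
  · exact Subtype.ext (by rw [Submodule.coe_neg, ← hu, ← hv, huv, map_neg])

end

/-- In a space satisfying Clarkson's inequality with rigid equality case, there are no points
`0, x, x', y` at the mutual distances of `0, a, -a, b`, where `a = 2^{-1/p}(e₁+e₂)` and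
`b = 2^{-1/p}(e₁-e₂)` in `ℓ_p`. -/
theorem false_of_clarkson {E : Type*} [NormedAddCommGroup E] {p d : ℝ} (hp : 0 < p)
    (clarkson : ∀ x y : E, ‖x + y‖ ^ p + ‖x - y‖ ^ p ≤ 2 ^ (p - 1) * (‖x‖ ^ p + ‖y‖ ^ p) ∧
      (‖x + y‖ ^ p + ‖x - y‖ ^ p = 2 ^ (p - 1) * (‖x‖ ^ p + ‖y‖ ^ p) → x = y ∨ x = -y))
    (hd0 : 0 < d) (hd : d ^ p = 2 ^ (p - 1)) {x x' y : E} (hx : ‖x‖ = 1) (hx' : ‖x'‖ = 1)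
    (hy : ‖y‖ = 1) (hxx : ‖x - x'‖ = 2) (hxy : ‖x - y‖ = d) (hxy' : ‖x' - y‖ = d) : False := by
  have two : (2 : ℝ) ^ p = 2 ^ (p - 1) * 2 := by
    rw [← Real.rpow_add_one two_ne_zero, sub_add_cancel]
  have anti : x' = -x := by
    have h := (clarkson x x').1
    rw [hx, hx', hxx, Real.one_rpow, two] at h
    have h0 : ‖x + x'‖ ^ p = 0 := le_antisymm (by linarith) (by positivity)
    rw [Real.rpow_eq_zero (norm_nonneg _) hp.ne', norm_eq_zero] at h0
    exact eq_neg_of_add_eq_zero_right h0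
  have hadd : ‖x + y‖ = d := by
    rw [← hxy', anti, ← norm_neg]
    congr 1
    abel
  rcases (clarkson x y).2 (by rw [hx, hy, hxy, hadd, hd, Real.one_rpow]; ring) with h | h
  · rw [h, sub_self, norm_zero] at hxy
    exact hd0.ne hxy
  · rw [h, neg_add_cancel, norm_zero] at hadd
    exact hd0.ne hadd

/-- **There is no finitely isometric Krivine theorem, case `2 < p < ∞`.**
For each `2 < p < ∞` there exists a Banach space `X` isomorphic to `ℓ_p` such that the set
`V = {2^{-1/p}(e₁+e₂), -2^{-1/p}(e₁+e₂), 2^{-1/p}(e₁-e₂), -2^{-1/p}(e₁-e₂), 0} ⊆ ℓ_p`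
does not embed isometrically into `X`. -/
theorem no_finite_isometric_krivine_gt_two (p : ℝ) (hp : 2 < p) :
    haveI : Fact ((1 : ℝ≥0∞) ≤ ENNReal.ofReal p) :=
      ⟨ENNReal.one_le_ofReal.mpr (by linarith)⟩
    ∃ (X : Type) (_ : NormedAddCommGroup X) (_ : NormedSpace ℝ X) (_ : CompleteSpace X),
      Nonempty (lp (fun _ : ℕ => ℝ) (ENNReal.ofReal p) ≃L[ℝ] X) ∧
      ¬ ∃ f : ({((2 : ℝ) ^ (-(1 : ℝ) / p)) • (lp.single (ENNReal.ofReal p) 0 (1 : ℝ) +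
                  lp.single (ENNReal.ofReal p) 1 (1 : ℝ)),
                -(((2 : ℝ) ^ (-(1 : ℝ) / p)) • (lp.single (ENNReal.ofReal p) 0 (1 : ℝ) +
                  lp.single (ENNReal.ofReal p) 1 (1 : ℝ))),
                ((2 : ℝ) ^ (-(1 : ℝ) / p)) • (lp.single (ENNReal.ofReal p) 0 (1 : ℝ) -
                  lp.single (ENNReal.ofReal p) 1 (1 : ℝ)),
                -(((2 : ℝ) ^ (-(1 : ℝ) / p)) • (lp.single (ENNReal.ofReal p) 0 (1 : ℝ) -
                  lp.single (ENNReal.ofReal p) 1 (1 : ℝ))), 0} :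
              Set (lp (fun _ : ℕ => ℝ) (ENNReal.ofReal p))) → X,
          ∀ u v, ‖f u - f v‖ =
            ‖(u : lp (fun _ : ℕ => ℝ) (ENNReal.ofReal p)) -
             (v : lp (fun _ : ℕ => ℝ) (ENNReal.ofReal p))‖ := by
  generalize_proofs _ this
  have toReal : (ENNReal.ofReal p).toReal = p := ENNReal.toReal_ofReal (by linarith)
  generalize ENNReal.ofReal p = P at this toReal ⊢
  subst toReal
  have hpos : 0 < P.toReal := by linarith
  have closed : IsClosed (Set.range (graphEmbedding P)) :=
    (graphEmbedding_antilipschitz P).isClosed_range (graphEmbedding P).uniformContinuous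
  refine ⟨(graphEmbedding P).range, inferInstance, inferInstance, closed.completeSpace_coe,
    ⟨(graphEmbedding P).equivRange (graphEmbedding_antilipschitz P).injective closed⟩, ?_⟩
  rintro ⟨f, hf⟩
  generalize hc : (2 : ℝ) ^ (-(1 : ℝ) / P.toReal) = c at f hf
  have hc0 : 0 < c := hc ▸ Real.rpow_pos_of_pos two_pos _
  have hcP : c ^ P.toReal = 2⁻¹ := by
    rw [← hc, ← Real.rpow_mul two_pos.le, div_mul_cancel₀ _ hpos.ne', Real.rpow_neg_one]
  have hdP : (2 * c) ^ P.toReal = 2 ^ (P.toReal - 1) := by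
    rw [Real.mul_rpow two_pos.le hc0.le, hcP, Real.rpow_sub_one two_ne_zero, div_eq_mul_inv]
  have norm_single_smul (i : ℕ) :
      ‖(2 * c) • (lp.single P i (1 : ℝ) : lp (fun _ : ℕ => ℝ) P)‖ = 2 * c := by
    rw [norm_smul, lp.norm_single (zero_lt_one.trans_le this.out), norm_one, mul_one,
      Real.norm_of_nonneg (by positivity)]
  have norm_a := lp_norm_smul_single_add P hpos hc0.le hcP
  have norm_b := lp_norm_smul_single_sub P hpos hc0.le hcP
  have diff₁ := norm_single_smul 1
  have diff₀ := norm_single_smul 0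
  generalize (lp.single P 0 (1 : ℝ) : lp (fun _ : ℕ => ℝ) P) = e₀ at *
  generalize (lp.single P 1 (1 : ℝ) : lp (fun _ : ℕ => ℝ) P) = e₁ at *
  refine false_of_clarkson hpos (graphEmbedding_range_clarkson P hp) (mul_pos two_pos hc0) hdP
    (x := f ⟨c • (e₀ + e₁), by simp⟩ - f ⟨0, by simp⟩)
    (x' := f ⟨-(c • (e₀ + e₁)), by simp⟩ - f ⟨0, by simp⟩)
    (y := f ⟨c • (e₀ - e₁), by simp⟩ - f ⟨0, by simp⟩) ?_ ?_ ?_ ?_ ?_ ?_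
  · rw [hf, sub_zero, norm_a]
  · rw [hf, sub_zero, norm_neg, norm_a]
  · rw [hf, sub_zero, norm_b]
  · rw [sub_sub_sub_cancel_right, hf, sub_neg_eq_add, ← two_smul ℝ, norm_smul, norm_a]
    norm_num
  · rw [sub_sub_sub_cancel_right, hf, ← diff₁]
    congr 1
    module
  · rw [sub_sub_sub_cancel_right, hf, ← diff₀, ← norm_neg]
    congr 1
    module
end

section
/- Let X be an infinite-dimensional real Banach space with the following property: for every finite subset F of ℓ₂ and every ε > 0 there exist a map f : F → X and a scale s > 0 such that s·‖u − v‖₂ ≤ ‖f(u) − f(v)‖_X ≤ s·(1+ε)·‖u − v‖₂ for all u, v ∈ F (i.e., F embeds into X with distortion at most 1+ε). Then for every n ∈ ℕ and every ε > 0 there exist an n-dimensional linear subspace Xₙ ⊆ X and a linear isomorphism T : Xₙ → ℓ₂ⁿ with ‖T‖·‖T⁻¹‖ ≤ 1 + ε. -/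
open scoped ENNReal

open Filter Topology

/-- A one-sided first-order expansion of the Euclidean norm at infinity. -/
lemma norm_add_smul_le {E : Type*} [NormedAddCommGroup E] [InnerProductSpace ℝ E]
    (z a : E) {M : ℝ} (hM : 0 < M) (ha : a ≠ 0) :
    ‖z + M • a‖ ≤ M * ‖a‖ + inner ℝ z a / ‖a‖ + ‖z‖ ^ 2 / (2 * (M * ‖a‖)) := by
  have ha' : 0 < ‖a‖ := norm_pos_iff.2 ha
  have hsq : ‖z + M • a‖ ^ 2 = ‖z‖ ^ 2 + 2 * (M * inner ℝ z a) + (M * ‖a‖) ^ 2 := by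
    rw [norm_add_sq_real, inner_smul_right, norm_smul, Real.norm_of_nonneg hM.le]
  have key : ‖z + M • a‖ ≤ (‖z + M • a‖ ^ 2 + (M * ‖a‖) ^ 2) / (2 * (M * ‖a‖)) := by
    rw [le_div_iff₀ (by positivity)]
    nlinarith [sq_nonneg (‖z + M • a‖ - M * ‖a‖)]
  refine key.trans (le_of_eq ?_)
  rw [hsq]
  field_simp
  ring

/-- Far away in the direction `a`, the sum of the distances from `z + a` and `z` to the points
`M • a` and `-M • a` is almost `2 * M * ‖a‖ - ‖a‖`. -/
lemma eventually_norm_add_norm_le {E : Type*} [NormedAddCommGroup E] [InnerProductSpace ℝ E]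
    (z a : E) {η : ℝ} (hη : 0 < η) :
    ∀ᶠ M : ℝ in atTop, ‖M • a - (z + a)‖ + ‖z + M • a‖ ≤ 2 * M * ‖a‖ - ‖a‖ + η ∨ a = 0 := by
  by_cases ha : a = 0
  · simp [ha]
  have ha' : 0 < ‖a‖ := norm_pos_iff.2 ha
  have hlim : Tendsto (fun M : ℝ => (‖z + a‖ ^ 2 + ‖z‖ ^ 2) / (2 * ‖a‖) / M) atTop (𝓝 0) :=
    tendsto_const_nhds.div_atTop tendsto_id
  filter_upwards [hlim.eventually_lt_const hη, eventually_gt_atTop 0] with M hMη hM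
  left
  have h1 := norm_add_smul_le z a hM ha
  have h2 := norm_add_smul_le (-(z + a)) a hM ha
  rw [neg_add_eq_sub, norm_neg, inner_neg_left, inner_add_left,
    real_inner_self_eq_norm_sq] at h2
  have e1 : -(inner ℝ z a + ‖a‖ ^ 2) / ‖a‖ = -(inner ℝ z a / ‖a‖) - ‖a‖ := by
    field_simp
    ring
  have e2 : ‖z + a‖ ^ 2 / (2 * (M * ‖a‖)) + ‖z‖ ^ 2 / (2 * (M * ‖a‖))
      = (‖z + a‖ ^ 2 + ‖z‖ ^ 2) / (2 * ‖a‖) / M := by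
    field_simp
  rw [e1] at h2
  linarith

/-- If finite subsets of an inner product space `E` embed almost isometrically into `X`, then on
finite sets one can choose the embedding such that the increments in a given direction are almost
normed by a single functional, regardless of the base point. -/
lemma exists_increments_normed {E X : Type*} [NormedAddCommGroup E] [InnerProductSpace ℝ E]
    [NormedAddCommGroup X] [NormedSpace ℝ X]
    (h : ∀ (F : Finset E) (ε : ℝ), 0 < ε → ∃ f : E → X, ∀ u ∈ F, ∀ v ∈ F,
      ‖u - v‖ ≤ ‖f u - f v‖ ∧ ‖f u - f v‖ ≤ (1 + ε) * ‖u - v‖)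
    (B A : Finset E) {η : ℝ} (hη : 0 < η) :
    ∃ f : E → X, ∀ a ∈ A, (∀ z ∈ B, ‖f (z + a) - f z‖ ≤ (1 + η) * ‖a‖) ∧
      ∃ φ : X →L[ℝ] ℝ, ‖φ‖ ≤ 1 ∧ ∀ z ∈ B, ‖a‖ - η ≤ φ (f (z + a) - f z) := by
  classical
  have hM : ∀ᶠ M : ℝ in atTop, ∀ p ∈ B ×ˢ A,
      ‖M • p.2 - (p.1 + p.2)‖ + ‖p.1 + M • p.2‖ ≤ 2 * M * ‖p.2‖ - ‖p.2‖ + η / 2 ∨ p.2 = 0 :=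
    (Finset.eventually_all _).2 fun p _ => eventually_norm_add_norm_le p.1 p.2 (half_pos hη)
  obtain ⟨M, hM, hM0⟩ := (hM.and (eventually_gt_atTop 0)).exists
  have hε : ∀ᶠ ε : ℝ in 𝓝[>] 0, ∀ p ∈ B ×ˢ A,
      ε * (‖M • p.2 - (p.1 + p.2)‖ + ‖p.1 + M • p.2‖) < η / 2 := by
    refine (Finset.eventually_all _).2 fun p _ => ?_
    have : Tendsto (fun ε : ℝ => ε * (‖M • p.2 - (p.1 + p.2)‖ + ‖p.1 + M • p.2‖))
        (𝓝[>] 0) (𝓝 0) := by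
      refine Tendsto.mono_left ?_ nhdsWithin_le_nhds
      have hc : Continuous
          (fun ε : ℝ => ε * (‖M • p.2 - (p.1 + p.2)‖ + ‖p.1 + M • p.2‖)) := by fun_prop
      simpa using hc.tendsto 0
    exact this.eventually_lt_const (half_pos hη)
  obtain ⟨ε, ⟨hε, hε0⟩, hεη⟩ := ((hε.and (eventually_mem_nhdsWithin)).and
    ((eventually_lt_nhds hη).filter_mono nhdsWithin_le_nhds)).exists
  replace hε0 : 0 < ε := hε0
  obtain ⟨f, hf⟩ := h (B ∪ (B ×ˢ A).image (fun p => p.1 + p.2) ∪ A.image (fun a => M • a) ∪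
    A.image (fun a => -(M • a))) ε hε0
  refine ⟨f, fun a ha => ⟨fun z hz => ?_, ?_⟩⟩
  · have := (hf (z + a) (by simp; grind) z (by simp [hz])).2
    rw [add_sub_cancel_left] at this
    refine this.trans ?_
    gcongr
  · obtain ⟨φ, hφ, hφw⟩ := exists_dual_vector'' ℝ (f (M • a) - f (-(M • a)))
    refine ⟨φ, hφ, fun z hz => ?_⟩
    have hφle : ∀ x, φ x ≤ ‖x‖ := fun x =>
      (le_abs_self _).trans ((φ.le_of_opNorm_le hφ x).trans (by simp))
    rcases hM (z, a) (by simp [hz, ha]) with h0 | h0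
    · have m1 : M • a ∈ B ∪ (B ×ˢ A).image (fun p => p.1 + p.2) ∪ A.image (fun a => M • a) ∪
          A.image (fun a => -(M • a)) := by
        simp only [Finset.mem_union, Finset.mem_image]; grind
      have m2 : -(M • a) ∈ B ∪ (B ×ˢ A).image (fun p => p.1 + p.2) ∪ A.image (fun a => M • a) ∪
          A.image (fun a => -(M • a)) := by
        simp only [Finset.mem_union, Finset.mem_image]; grind
      have m3 : z + a ∈ B ∪ (B ×ˢ A).image (fun p => p.1 + p.2) ∪ A.image (fun a => M • a) ∪
          A.image (fun a => -(M • a)) := by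
        simp; grind
      have h1 := (hf _ m1 _ m2).1
      have h2 := (hf _ m1 _ m3).2
      have h3 := (hf z (by simp [hz]) _ m2).2
      have h4 := hφle (f (M • a) - f (z + a))
      have h5 := hφle (f z - f (-(M • a)))
      have h6 := hε (z, a) (by simp [hz, ha])
      have h7 : ‖M • a - -(M • a)‖ = 2 * M * ‖a‖ := by
        rw [sub_neg_eq_add, ← two_smul ℝ, smul_smul, norm_smul, Real.norm_of_nonneg (by positivity)]
      have h8 : φ (f (z + a) - f z) = φ (f (M • a) - f (-(M • a))) - φ (f (M • a) - f (z + a))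
          - φ (f z - f (-(M • a))) := by
        rw [← map_sub, ← map_sub]
        congr 1
        abel
      simp only [RCLike.ofReal_real_eq_id, id] at hφw
      rw [sub_neg_eq_add] at h3
      simp only at h0 h6
      rw [h8, hφw]
      nlinarith
    · simp only at h0
      simp [h0, hη.le]

/-- The cube `{-N, …, N}ⁿ` in `ℤⁿ`. -/
noncomputable def intCube (n N : ℕ) : Finset (Fin n → ℤ) :=
  Finset.Icc (fun _ => -(N : ℤ)) (fun _ => (N : ℤ))

lemma mem_intCube {n N : ℕ} {a : Fin n → ℤ} : a ∈ intCube n N ↔ ∀ i, |a i| ≤ N := by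
  simp [intCube, Pi.le_def, abs_le, forall_and]

lemma card_intCube (n N : ℕ) : (intCube n N).card = (2 * N + 1) ^ n := by
  rw [intCube, Pi.card_Icc]
  simp only [Int.card_Icc, Finset.prod_const, Finset.card_univ, Fintype.card_fin]
  congr 1
  omega

lemma exists_mem_intCube {n : ℕ} (a : Fin n → ℤ) : ∃ m, ∀ N, m ≤ N → a ∈ intCube n N := by
  refine ⟨∑ i, (a i).natAbs, fun N hN => mem_intCube.2 fun i => ?_⟩
  have := Finset.single_le_sum (f := fun i => (a i).natAbs) (fun _ _ => Nat.zero_le _)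
    (Finset.mem_univ i)
  rw [Int.abs_eq_natAbs]
  omega

lemma add_mem_intCube {n N M : ℕ} {a b : Fin n → ℤ} (ha : a ∈ intCube n N)
    (hb : b ∈ intCube n M) : a + b ∈ intCube n (N + M) := by
  rw [mem_intCube] at *
  intro i
  have := abs_add_le (a i) (b i)
  have := ha i
  have := hb i
  simp only [Pi.add_apply]
  push_cast
  omega

lemma intCube_mono {n N M : ℕ} (h : N ≤ M) : intCube n N ⊆ intCube n M := by
  intro a ha
  rw [mem_intCube] at *
  exact fun i => (ha i).trans (by exact_mod_cast h)

/-- Sums over a cube are almost invariant under translations. -/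
lemma norm_sum_intCube_shift_le {X : Type*} [NormedAddCommGroup X] {n N m : ℕ}
    {a : Fin n → ℤ} (ha : a ∈ intCube n m) (g : (Fin n → ℤ) → X) {C : ℝ}
    (hg : ∀ z ∈ intCube n (N + m), ‖g z‖ ≤ C) :
    ‖∑ z ∈ intCube n N, g (z + a) - ∑ z ∈ intCube n N, g z‖ ≤
      2 * C * ((intCube n (N + m)).card - (intCube n N).card) := by
  classical
  have key : ∀ S ⊆ intCube n (N + m), S.card = (intCube n N).card →
      ‖∑ z ∈ intCube n (N + m), g z - ∑ z ∈ S, g z‖ ≤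
        C * ((intCube n (N + m)).card - (intCube n N).card) := by
    intro S hS hc
    rw [← Finset.sum_sdiff hS, add_sub_cancel_right]
    refine (norm_sum_le_of_le (n := fun _ => C) _
      fun z hz => hg z (Finset.mem_sdiff.1 hz).1).trans (le_of_eq ?_)
    rw [Finset.sum_const, nsmul_eq_mul, Finset.card_sdiff_of_subset hS,
      Nat.cast_sub (Finset.card_le_card hS), hc, mul_comm]
  have h1 := key (intCube n N) (intCube_mono (Nat.le_add_right _ _)) rfl
  have h2 := key ((intCube n N).map (addRightEmbedding a)) (by
    intro z hz
    obtain ⟨w, hw, rfl⟩ := Finset.mem_map.1 hz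
    exact add_mem_intCube hw ha) (Finset.card_map _)
  rw [Finset.sum_map] at h2
  simp only [addRightEmbedding_apply] at h2
  have := norm_sub_le_norm_sub_add_norm_sub (∑ z ∈ intCube n N, g (z + a))
    (∑ z ∈ intCube n (N + m), g z) (∑ z ∈ intCube n N, g z)
  rw [norm_sub_rev] at h2
  linarith

lemma tendsto_card_intCube_ratio (n m : ℕ) :
    Tendsto (fun N : ℕ => (((intCube n (N + m)).card : ℝ) - (intCube n N).card) /
      (intCube n N).card) atTop (𝓝 0) := by
  have h1 : Tendsto (fun N : ℕ => (1 + (2 * m : ℝ) / (2 * N + 1)) ^ n - 1) atTop (𝓝 0) := by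
    have h0 : Tendsto (fun N : ℕ => (2 * m : ℝ) / (2 * N + 1)) atTop (𝓝 0) :=
      tendsto_const_nhds.div_atTop (tendsto_atTop_add_const_right _ _
        (tendsto_natCast_atTop_atTop.const_mul_atTop two_pos))
    simpa using ((h0.const_add 1).pow n).sub_const 1
  refine h1.congr fun N => ?_
  rw [card_intCube, card_intCube, sub_div, div_self (by positivity)]
  push_cast
  rw [← div_pow]
  congr 2
  field_simp
  ring

/-- The inclusion of `ℤⁿ` in Euclidean space. -/
noncomputable def intVec (n : ℕ) : (Fin n → ℤ) →+ EuclideanSpace ℝ (Fin n) where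
  toFun a := WithLp.toLp 2 fun i => (a i : ℝ)
  map_zero' := by ext; simp
  map_add' a b := by ext; simp

@[simp]
lemma intVec_apply {n : ℕ} (a : Fin n → ℤ) (i : Fin n) : intVec n a i = a i := rfl

lemma intVec_single {n : ℕ} (i : Fin n) :
    intVec n (Pi.single i 1) = EuclideanSpace.single i 1 := by
  ext j
  by_cases hj : j = i <;> simp [hj]

/-- The average over a cube of the increments of `g` in the direction `a`. -/
noncomputable def avgIncr {X : Type*} [NormedAddCommGroup X] [NormedSpace ℝ X] {n : ℕ}
    (N : ℕ) (g : (Fin n → ℤ) → X) (a : Fin n → ℤ) : X :=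
  ((intCube n N).card : ℝ)⁻¹ • ∑ z ∈ intCube n N, (g (z + a) - g z)

section Increments

variable {X : Type*} [NormedAddCommGroup X] [NormedSpace ℝ X] {n : ℕ}

lemma card_intCube_pos (n N : ℕ) : (0 : ℝ) < (intCube n N).card := by
  rw [card_intCube]
  positivity

lemma norm_avgIncr_le {N : ℕ} {g : (Fin n → ℤ) → X} {a : Fin n → ℤ} {C : ℝ}
    (h : ∀ z ∈ intCube n N, ‖g (z + a) - g z‖ ≤ C) : ‖avgIncr N g a‖ ≤ C := by
  have hc := card_intCube_pos n N
  rw [avgIncr, norm_smul, norm_inv, Real.norm_of_nonneg hc.le, inv_mul_le_iff₀ hc]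
  refine (norm_sum_le_of_le _ h).trans (le_of_eq ?_)
  simp

lemma le_norm_avgIncr {N : ℕ} {g : (Fin n → ℤ) → X} {a : Fin n → ℤ} {c : ℝ} {φ : X →L[ℝ] ℝ}
    (hφ : ‖φ‖ ≤ 1) (h : ∀ z ∈ intCube n N, c ≤ φ (g (z + a) - g z)) : c ≤ ‖avgIncr N g a‖ := by
  have hc := card_intCube_pos n N
  have h1 : φ (avgIncr N g a) ≤ ‖avgIncr N g a‖ :=
    (le_abs_self _).trans ((φ.le_of_opNorm_le hφ _).trans (by simp))
  refine le_trans ?_ h1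
  rw [avgIncr, map_smul, map_sum, smul_eq_mul, le_inv_mul_iff₀ hc, ← nsmul_eq_mul,
    ← Finset.sum_const]
  exact Finset.sum_le_sum h

lemma tendsto_avgIncr_add {g : ℕ → (Fin n → ℤ) → X} {C : (Fin n → ℤ) → ℝ}
    (hg : ∀ N, ∀ a ∈ intCube n N, ∀ z ∈ intCube n (N + N), ‖g N (z + a) - g N z‖ ≤ C a)
    (a b : Fin n → ℤ) :
    Tendsto (fun N => avgIncr N (g N) (a + b) - avgIncr N (g N) a - avgIncr N (g N) b)
      atTop (𝓝 0) := by
  obtain ⟨m, hm⟩ := exists_mem_intCube a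
  obtain ⟨k, hk⟩ := exists_mem_intCube b
  have hlim := (tendsto_card_intCube_ratio n m).const_mul (2 * C b)
  rw [mul_zero] at hlim
  refine squeeze_zero_norm' ?_ hlim
  filter_upwards [eventually_ge_atTop m, eventually_ge_atTop k] with N hN hN'
  have hc := card_intCube_pos n N
  have key := norm_sum_intCube_shift_le (N := N) (hm m le_rfl)
    (fun z => g N (z + b) - g N z) (C := C b)
    fun z hz => hg N b (hk N hN') z (intCube_mono (by omega) hz)
  have e : avgIncr N (g N) (a + b) - avgIncr N (g N) a - avgIncr N (g N) b =
      ((intCube n N).card : ℝ)⁻¹ • (∑ z ∈ intCube n N, (g N (z + a + b) - g N (z + a)) -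
        ∑ z ∈ intCube n N, (g N (z + b) - g N z)) := by
    simp only [avgIncr, ← smul_sub, ← Finset.sum_sub_distrib, add_assoc]
    congr 1
    refine Finset.sum_congr rfl fun z _ => ?_
    abel
  rw [e, norm_smul, norm_inv, Real.norm_of_nonneg hc.le, inv_mul_le_iff₀ hc]
  refine key.trans (le_of_eq ?_)
  field_simp

/-- The linear map which agrees with the averaged increments on the standard basis. -/
noncomputable def avgLin (N : ℕ) (g : (Fin n → ℤ) → X) : EuclideanSpace ℝ (Fin n) →ₗ[ℝ] X :=
  (EuclideanSpace.basisFun (Fin n) ℝ).toBasis.constr ℝ fun i => avgIncr N g (Pi.single i 1)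

lemma avgLin_single (N : ℕ) (g : (Fin n → ℤ) → X) (i : Fin n) :
    avgLin N g (EuclideanSpace.single i 1) = avgIncr N g (Pi.single i 1) := by
  simp [avgLin, Module.Basis.constr_apply_fintype]

lemma tendsto_avgIncr_sub_avgLin {g : ℕ → (Fin n → ℤ) → X} {C : (Fin n → ℤ) → ℝ}
    (hg : ∀ N, ∀ a ∈ intCube n N, ∀ z ∈ intCube n (N + N), ‖g N (z + a) - g N z‖ ≤ C a)
    (a : Fin n → ℤ) :
    Tendsto (fun N => avgIncr N (g N) a - avgLin N (g N) (intVec n a)) atTop (𝓝 0) := by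
  have hadd := tendsto_avgIncr_add hg
  let S : AddSubgroup (Fin n → ℤ) :=
    { carrier := {a | Tendsto (fun N => avgIncr N (g N) a - avgLin N (g N) (intVec n a))
        atTop (𝓝 0)}
      zero_mem' := by simp [avgIncr]
      add_mem' := by
        intro a b ha hb
        have := ((hadd a b).add ha).add hb
        simp only [add_zero] at this
        refine this.congr fun N => ?_
        simp only [map_add]
        abel
      neg_mem' := by
        intro a ha
        have := ((hadd a (-a)).add ha).neg
        simp only [add_zero, neg_zero] at this
        refine this.congr fun N => ?_
        simp only [map_neg, add_neg_cancel]
        simp only [avgIncr, add_zero, sub_self, Finset.sum_const_zero, smul_zero]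
        abel }
  have hsingle : ∀ i, Pi.single i 1 ∈ S := by
    intro i
    change Tendsto _ _ _
    simp [intVec_single, avgLin_single]
  change a ∈ S
  have ha : a = ∑ i, a i • Pi.single i 1 := by
    ext j
    simp [Finset.sum_apply, Pi.single_apply]
  rw [ha]
  exact S.sum_mem fun i _ => S.zsmul_mem (hsingle i) _

/-- If finite subsets of Euclidean space embed almost isometrically into `X`, there are linear
maps into `X` almost preserving the norms of finitely many integer vectors. -/
lemma exists_linearMap_intVec
    (h : ∀ (F : Finset (EuclideanSpace ℝ (Fin n))) (ε : ℝ), 0 < ε →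
      ∃ f : EuclideanSpace ℝ (Fin n) → X, ∀ u ∈ F, ∀ v ∈ F,
        ‖u - v‖ ≤ ‖f u - f v‖ ∧ ‖f u - f v‖ ≤ (1 + ε) * ‖u - v‖)
    (A : Finset (Fin n → ℤ)) :
    ∃ L : EuclideanSpace ℝ (Fin n) →ₗ[ℝ] X, ∀ a ∈ A, |‖L (intVec n a)‖ - ‖intVec n a‖| ≤ 1 := by
  classical
  have hex : ∀ N : ℕ, ∃ g : (Fin n → ℤ) → X, ∀ a ∈ intCube n N,
      (∀ z ∈ intCube n (N + N),
        ‖g (z + a) - g z‖ ≤ (1 + 1 / ((N : ℝ) + 1)) * ‖intVec n a‖) ∧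
      ∃ φ : X →L[ℝ] ℝ, ‖φ‖ ≤ 1 ∧ ∀ z ∈ intCube n (N + N),
        ‖intVec n a‖ - 1 / ((N : ℝ) + 1) ≤ φ (g (z + a) - g z) := by
    intro N
    obtain ⟨f, hf⟩ := exists_increments_normed h ((intCube n (N + N)).image (intVec n))
      ((intCube n N).image (intVec n)) (η := 1 / ((N : ℝ) + 1)) (by positivity)
    refine ⟨f ∘ intVec n, fun a ha => ?_⟩
    obtain ⟨h1, φ, hφ, h2⟩ := hf _ (Finset.mem_image_of_mem _ ha)
    refine ⟨fun z hz => ?_, φ, hφ, fun z hz => ?_⟩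
    · simpa using h1 _ (Finset.mem_image_of_mem _ hz)
    · simpa using h2 _ (Finset.mem_image_of_mem _ hz)
  choose g hg using hex
  have hbound : ∀ N, ∀ a ∈ intCube n N, ∀ z ∈ intCube n (N + N),
      ‖g N (z + a) - g N z‖ ≤ 2 * ‖intVec n a‖ := by
    intro N a ha z hz
    refine ((hg N a ha).1 z hz).trans ?_
    gcongr
    have : 1 / ((N : ℝ) + 1) ≤ 1 := by
      rw [div_le_one (by positivity)]
      simp
    linarith
  have hinv : Tendsto (fun N : ℕ => 1 / ((N : ℝ) + 1)) atTop (𝓝 0) :=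
    tendsto_one_div_add_atTop_nhds_zero_nat
  have hnorm : ∀ a, Tendsto (fun N => ‖avgIncr N (g N) a‖) atTop (𝓝 ‖intVec n a‖) := by
    intro a
    obtain ⟨m, hm⟩ := exists_mem_intCube a
    refine tendsto_of_tendsto_of_tendsto_of_le_of_le'
      (g := fun N : ℕ => ‖intVec n a‖ - 1 / ((N : ℝ) + 1))
      (h := fun N : ℕ => (1 + 1 / ((N : ℝ) + 1)) * ‖intVec n a‖) ?_ ?_ ?_ ?_
    · simpa using hinv.const_sub ‖intVec n a‖
    · simpa using (hinv.const_add 1).mul_const ‖intVec n a‖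
    · filter_upwards [eventually_ge_atTop m] with N hN
      obtain ⟨-, φ, hφ, h2⟩ := hg N a (hm N hN)
      exact le_norm_avgIncr hφ fun z hz => h2 z (intCube_mono (by omega) hz)
    · filter_upwards [eventually_ge_atTop m] with N hN
      exact norm_avgIncr_le fun z hz => (hg N a (hm N hN)).1 z (intCube_mono (by omega) hz)
  have hL : ∀ a, Tendsto (fun N => ‖avgLin N (g N) (intVec n a)‖ - ‖intVec n a‖)
      atTop (𝓝 0) := by
    intro a
    have h1 := (tendsto_avgIncr_sub_avgLin hbound a).norm
    rw [norm_zero] at h1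
    have h2 : Tendsto (fun N => ‖avgLin N (g N) (intVec n a)‖ - ‖avgIncr N (g N) a‖)
        atTop (𝓝 0) := by
      refine squeeze_zero_norm (fun N => ?_) h1
      rw [norm_sub_rev]
      exact abs_norm_sub_norm_le _ _
    have h3 := h2.add ((hnorm a).sub_const ‖intVec n a‖)
    simpa using h3
  have hev : ∀ᶠ N in atTop, ∀ a ∈ A, |‖avgLin N (g N) (intVec n a)‖ - ‖intVec n a‖| < 1 := by
    refine (Finset.eventually_all _).2 fun a _ => ?_
    have := (hL a).abs
    rw [abs_zero] at this
    exact this.eventually_lt_const one_pos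
  obtain ⟨N, hN⟩ := hev.exists
  exact ⟨avgLin N (g N), fun a ha => (hN a ha).le⟩

lemma norm_map_le_sum_abs {Y : Type*} [SeminormedAddCommGroup Y] [NormedSpace ℝ Y]
    (L : EuclideanSpace ℝ (Fin n) →ₗ[ℝ] Y) {C : ℝ}
    (hL : ∀ i, ‖L (EuclideanSpace.single i 1)‖ ≤ C) (y : EuclideanSpace ℝ (Fin n)) :
    ‖L y‖ ≤ ∑ i, |y i| * C := by
  have hy : y = ∑ i, y i • EuclideanSpace.single i (1 : ℝ) := by
    ext j
    simp [Pi.single_apply]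
  conv_lhs => rw [hy, map_sum]
  refine norm_sum_le_of_le _ fun i _ => ?_
  rw [map_smul, norm_smul, Real.norm_eq_abs]
  gcongr
  exact hL i

/-- If finite subsets of Euclidean space embed almost isometrically into `X`, then Euclidean space
embeds linearly and almost isometrically into `X`. -/
lemma exists_linearMap_almost_isometry
    (h : ∀ (F : Finset (EuclideanSpace ℝ (Fin n))) (ε : ℝ), 0 < ε →
      ∃ f : EuclideanSpace ℝ (Fin n) → X, ∀ u ∈ F, ∀ v ∈ F,
        ‖u - v‖ ≤ ‖f u - f v‖ ∧ ‖f u - f v‖ ≤ (1 + ε) * ‖u - v‖)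
    {δ : ℝ} (hδ : 0 < δ) :
    ∃ L : EuclideanSpace ℝ (Fin n) →ₗ[ℝ] X, ∀ x, |‖L x‖ - ‖x‖| ≤ δ * ‖x‖ := by
  obtain ⟨R, hR⟩ := exists_nat_gt ((3 * n + 1) / δ)
  have hR0 : (0 : ℝ) < R := lt_of_le_of_lt (by positivity) hR
  rw [div_lt_iff₀ hδ] at hR
  obtain ⟨L, hL⟩ := exists_linearMap_intVec h (intCube n (R + 1))
  refine ⟨L, fun x => ?_⟩
  have hsingle : ∀ i, ‖L (EuclideanSpace.single i 1)‖ ≤ 2 := by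
    intro i
    have := hL (Pi.single i 1) (mem_intCube.2 fun j => by
      by_cases hj : j = i
      · simp [hj]
      · simp only [Pi.single_eq_of_ne hj, abs_zero]
        positivity)
    rw [intVec_single, PiLp.norm_single, norm_one] at this
    linarith [(abs_le.1 this).2]
  rcases eq_or_ne x 0 with rfl | hx
  · simp
  have hx0 : 0 < ‖x‖ := norm_pos_iff.2 hx
  have hy : ‖(R / ‖x‖) • x‖ = R := by
    rw [norm_smul, Real.norm_of_nonneg (by positivity)]
    field_simp
  set y := ((R : ℝ) / ‖x‖) • x with hydef
  set a : Fin n → ℤ := fun i => round (y i) with hadef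
  have hya : ∀ i, |(y - intVec n a) i| ≤ 1 := fun i => by
    have := abs_sub_round (y i)
    simp only [PiLp.sub_apply, intVec_apply, hadef]
    linarith
  have ha : a ∈ intCube n (R + 1) := by
    refine mem_intCube.2 fun i => ?_
    have h1 := hya i
    have h2 : |y i| ≤ R := by
      rw [← hy]
      exact PiLp.norm_apply_le y i
    simp only [PiLp.sub_apply, intVec_apply] at h1
    have h3 : |(a i : ℝ)| ≤ R + 1 := by
      have := abs_sub_abs_le_abs_sub ((a i : ℝ)) (y i)
      rw [abs_sub_comm] at this
      linarith
    exact_mod_cast h3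
  have h1 := hL a ha
  have h2 : ‖L (y - intVec n a)‖ ≤ 2 * n := by
    refine (norm_map_le_sum_abs L hsingle _).trans
      ((Finset.sum_le_sum fun i _ => mul_le_mul_of_nonneg_right (hya i) two_pos.le).trans ?_)
    simp [mul_comm]
  have h3 : ‖y - intVec n a‖ ≤ n := by
    refine (norm_map_le_sum_abs LinearMap.id (C := 1) (by simp) _).trans
      ((Finset.sum_le_sum fun i _ => mul_le_mul_of_nonneg_right (hya i) one_pos.le).trans ?_)
    simp
  have h4 : |‖L y‖ - ‖L (intVec n a)‖| ≤ 2 * n :=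
    (abs_norm_sub_norm_le (L y) (L (intVec n a))).trans (by rwa [← map_sub])
  have h5 := (abs_norm_sub_norm_le y (intVec n a)).trans h3
  have h6 : |‖L y‖ - ‖y‖| ≤ δ * R := by
    rw [abs_le] at *
    constructor <;> linarith
  have h7 : ‖L y‖ = R / ‖x‖ * ‖L x‖ := by
    rw [hydef, map_smul, norm_smul, Real.norm_of_nonneg (by positivity)]
  have h8 : ‖L y‖ - ‖y‖ = R / ‖x‖ * (‖L x‖ - ‖x‖) := by
    rw [h7, hy]
    field_simp
  rw [h8, abs_mul, abs_of_pos (by positivity : (R : ℝ) / ‖x‖ > 0)] at h6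
  rw [div_mul_eq_mul_div, div_le_iff₀ hx0] at h6
  refine le_of_mul_le_mul_left ?_ hR0
  linarith

/-- The range of an almost isometric linear map is almost isometric to Euclidean space. -/
lemma exists_submodule_of_almost_isometry {δ : ℝ} (hδ0 : 0 < δ) (hδ1 : δ < 1)
    (L : EuclideanSpace ℝ (Fin n) →ₗ[ℝ] X) (hL : ∀ x, |‖L x‖ - ‖x‖| ≤ δ * ‖x‖) :
    ∃ Xn : Submodule ℝ X, Module.finrank ℝ Xn = n ∧
      ∃ T : Xn ≃L[ℝ] EuclideanSpace ℝ (Fin n),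
        ‖(T : Xn →L[ℝ] EuclideanSpace ℝ (Fin n))‖ *
          ‖(T.symm : EuclideanSpace ℝ (Fin n) →L[ℝ] Xn)‖ ≤ (1 - δ)⁻¹ * (1 + δ) := by
  have hd : 0 < 1 - δ := sub_pos.2 hδ1
  have hlow : ∀ x, (1 - δ) * ‖x‖ ≤ ‖L x‖ := fun x => by linarith [(abs_le.1 (hL x)).1]
  have hup : ∀ x, ‖L x‖ ≤ (1 + δ) * ‖x‖ := fun x => by linarith [(abs_le.1 (hL x)).2]
  have hinj : Function.Injective L := by
    refine (injective_iff_map_eq_zero L).2 fun x hx => ?_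
    have := hlow x
    rw [hx, norm_zero] at this
    exact norm_le_zero_iff.1 (nonpos_of_mul_nonpos_right this hd)
  let e := LinearEquiv.ofInjective L hinj
  refine ⟨LinearMap.range L, by rw [← e.finrank_eq]; simp,
    e.toContinuousLinearEquiv.symm, ?_⟩
  refine mul_le_mul ?_ ?_ (ContinuousLinearMap.opNorm_nonneg _) (by positivity)
  · refine ContinuousLinearMap.opNorm_le_bound _ (by positivity) fun w => ?_
    obtain ⟨x, rfl⟩ := e.surjective w
    have h1 : e.toContinuousLinearEquiv.symm (e x) = x := e.symm_apply_apply x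
    change ‖e.toContinuousLinearEquiv.symm (e x)‖ ≤ _
    rw [h1, le_inv_mul_iff₀ hd]
    exact hlow x
  · exact ContinuousLinearMap.opNorm_le_bound _ (by positivity) hup

end Increments

lemma exists_linearIsometry_lp (n : ℕ) :
    Nonempty (EuclideanSpace ℝ (Fin n) →ₗᵢ[ℝ] lp (fun _ : ℕ => ℝ) 2) := by
  let v : Fin n → lp (fun _ : ℕ => ℝ) 2 := fun i => lp.single 2 (i : ℕ) (1 : ℝ)
  have hv : Orthonormal ℝ v := by
    rw [orthonormal_iff_ite]
    intro i j
    simp only [v, lp.inner_single_left, lp.single_apply]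
    by_cases hij : i = j
    · simp [hij]
    · have : (i : ℕ) ≠ j := fun h => hij (Fin.ext h)
      simp [hij, this]
  let b := EuclideanSpace.basisFun (Fin n) ℝ
  exact ⟨(b.toBasis.constr ℝ v).isometryOfOrthonormal (v := b.toBasis)
    (by simp [b.orthonormal]) (by
      convert hv using 1
      ext1 i
      exact b.toBasis.constr_basis ℝ v i)⟩

/-- **The finite Dvoretzky theorem implies the Dvoretzky theorem.**
If `X` is an infinite-dimensional Banach space such that every finite subset of `ℓ₂`
embeds into `X` with distortion at most `1 + ε` (for every `ε > 0`), then for every `n`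
and every `ε > 0` there is an `n`-dimensional subspace `Xₙ ⊆ X` and a linear isomorphism
`T : Xₙ → ℓ₂ⁿ` with `‖T‖ ⬝ ‖T⁻¹‖ ≤ 1 + ε`. -/
theorem dvoretzky_of_finite_dvoretzky (X : Type*) [NormedAddCommGroup X]
    [NormedSpace ℝ X] [CompleteSpace X] (hX : ¬ FiniteDimensional ℝ X)
    (h : ∀ (F : Finset (lp (fun _ : ℕ => ℝ) 2)) (ε : ℝ), 0 < ε →
      ∃ (f : lp (fun _ : ℕ => ℝ) 2 → X) (s : ℝ), 0 < s ∧
        ∀ u ∈ F, ∀ v ∈ F,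
          s * ‖u - v‖ ≤ ‖f u - f v‖ ∧ ‖f u - f v‖ ≤ s * (1 + ε) * ‖u - v‖) :
    ∀ (n : ℕ) (ε : ℝ), 0 < ε →
      ∃ Xn : Submodule ℝ X, Module.finrank ℝ Xn = n ∧
        ∃ T : Xn ≃L[ℝ] EuclideanSpace ℝ (Fin n),
          ‖(T : Xn →L[ℝ] EuclideanSpace ℝ (Fin n))‖ *
            ‖(T.symm : EuclideanSpace ℝ (Fin n) →L[ℝ] Xn)‖ ≤ 1 + ε := by
  intro n ε hε
  obtain ⟨ι⟩ := exists_linearIsometry_lp n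
  have hE : ∀ (F : Finset (EuclideanSpace ℝ (Fin n))) (ε : ℝ), 0 < ε →
      ∃ f : EuclideanSpace ℝ (Fin n) → X, ∀ u ∈ F, ∀ v ∈ F,
        ‖u - v‖ ≤ ‖f u - f v‖ ∧ ‖f u - f v‖ ≤ (1 + ε) * ‖u - v‖ := by
    classical
    intro F ε hε
    obtain ⟨f, s, hs, hf⟩ := h (F.image ι) ε hε
    refine ⟨fun x => s⁻¹ • f (ι x), fun u hu v hv => ?_⟩
    have := hf _ (Finset.mem_image_of_mem _ hu) _ (Finset.mem_image_of_mem _ hv)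
    rw [← map_sub, ι.norm_map, mul_assoc] at this
    rw [← smul_sub, norm_smul, norm_inv, Real.norm_of_nonneg hs.le, le_inv_mul_iff₀ hs,
      inv_mul_le_iff₀ hs]
    exact this
  have hδ0 : 0 < ε / (2 + ε) := by positivity
  have hδ1 : ε / (2 + ε) < 1 := by
    rw [div_lt_one (by positivity)]
    linarith
  obtain ⟨L, hL⟩ := exists_linearMap_almost_isometry hE hδ0
  obtain ⟨Xn, hfr, T, hT⟩ := exists_submodule_of_almost_isometry hδ0 hδ1 L hL
  refine ⟨Xn, hfr, T, hT.trans (le_of_eq ?_)⟩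
  have : 1 - ε / (2 + ε) = 2 / (2 + ε) := by
    field_simp
    ring
  rw [this]
  field_simp
  ring
end
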